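/- Let H=(V,E) be an ℛ₂-connected graph with |V| ≥ 4 (such a graph is 2-connected), and let J₁, J₂, …, J_t be the 3-blocks of H. Then for every edge e ∈ E(H), the vertex sets V(J₁), …, V(J_t) admit a 2-shellable ordering such that both endpoints of e belong to the first set of the ordering. -/

import Mathlib

open scoped BigOperators

noncomputable section

namespace Rigidity

variable {V : Type*}

/-- Euclidean distance between two points of `ℝ^d` (given as coordinate functions). -/
def eDist {d : ℕ} (x y : Fin d → ℝ) : ℝ := Real.sqrt (∑ i, (x i - y i) ^ 2)

/-- Two frameworks `(G,p)` and `(G,q)` are equivalent if corresponding edge lengths agree. -/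
def Equivalent {d : ℕ} (G : SimpleGraph V) (p q : V → Fin d → ℝ) : Prop :=
  ∀ u v : V, G.Adj u v → eDist (p u) (p v) = eDist (q u) (q v)

/-- Two placements are congruent if all pairwise distances agree. -/
def Congruent {d : ℕ} (p q : V → Fin d → ℝ) : Prop :=
  ∀ u v : V, eDist (p u) (p v) = eDist (q u) (q v)

/-- A placement is generic if the multiset of its coordinates is algebraically
independent over `ℚ`. -/
def Generic {d : ℕ} (p : V → Fin d → ℝ) : Prop :=
  AlgebraicIndependent ℚ (fun vi : V × Fin d => p vi.1 vi.2)

/-- `{u,v}` is globally linked in the framework `(G,p)`. -/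
def GloballyLinkedIn {d : ℕ} (G : SimpleGraph V) (p : V → Fin d → ℝ) (u v : V) : Prop :=
  ∀ q : V → Fin d → ℝ, Equivalent G p q → eDist (q u) (q v) = eDist (p u) (p v)

/-- `{u,v}` is globally `d`-linked in `G`. -/
def GloballyLinked (d : ℕ) (G : SimpleGraph V) (u v : V) : Prop :=
  ∀ p : V → Fin d → ℝ, Generic p → GloballyLinkedIn G p u v

/-- The framework `(G,p)` is rigid. -/
def RigidFramework {d : ℕ} (G : SimpleGraph V) (p : V → Fin d → ℝ) : Prop :=
  ∃ ε > (0:ℝ), ∀ q : V → Fin d → ℝ, Equivalent G p q →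
    (∀ v, eDist (p v) (q v) < ε) → Congruent p q

/-- `G` is `d`-rigid: every generic framework of `G` in `ℝ^d` is rigid. -/
def IsRigidGraph (d : ℕ) (G : SimpleGraph V) : Prop :=
  ∀ p : V → Fin d → ℝ, Generic p → RigidFramework G p

/-- The framework `(G,p)` is globally rigid. -/
def GloballyRigidFramework {d : ℕ} (G : SimpleGraph V) (p : V → Fin d → ℝ) : Prop :=
  ∀ q : V → Fin d → ℝ, Equivalent G p q → Congruent p q

/-- The row of the rigidity matrix corresponding to the (ordered) edge `(u,v)`. -/
def edgeVec [DecidableEq V] {d : ℕ} (p : V → Fin d → ℝ) (u v : V) : V × Fin d → ℝ :=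
  fun wi => if wi.1 = u then p u wi.2 - p v wi.2
            else if wi.1 = v then p v wi.2 - p u wi.2 else 0

/-- The rank of the set of rows of the rigidity matrix of `(·,p)` indexed by `F`. -/
def rankAt [DecidableEq V] (d : ℕ) (p : V → Fin d → ℝ) (F : Set (Sym2 V)) : ℕ :=
  Module.finrank ℝ (Submodule.span ℝ
    {x : V × Fin d → ℝ | ∃ u v : V, s(u, v) ∈ F ∧ x = edgeVec p u v})

/-- `r_d(F)`: the rank of the set of rows indexed by `F` of the rigidity matrix of a
generic framework, equivalently the maximum of this rank over all placements. -/
def rd [DecidableEq V] (d : ℕ) (F : Set (Sym2 V)) : ℕ :=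
  sSup {n : ℕ | ∃ p : V → Fin d → ℝ, n = rankAt d p F}

/-- An edge set is `ℛ_d`-independent if its rank equals its cardinality. -/
def RdIndep [DecidableEq V] (d : ℕ) (F : Set (Sym2 V)) : Prop := rd d F = F.ncard

/-- An `ℛ_d`-circuit: not independent, but every proper subset is independent. -/
def RdCircuit [DecidableEq V] (d : ℕ) (C : Set (Sym2 V)) : Prop :=
  ¬ RdIndep d C ∧ ∀ C' : Set (Sym2 V), C' ⊂ C → RdIndep d C'

/-- An `ℛ_d`-circuit of the graph `G`. -/
def RdCircuitOf [DecidableEq V] (d : ℕ) (G : SimpleGraph V) (C : Set (Sym2 V)) : Prop :=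
  C ⊆ G.edgeSet ∧ RdCircuit d C

/-- `F` is (the edge set of) an `ℛ_d`-component of `G`: an equivalence class of the
relation "`e = f` or some `ℛ_d`-circuit of `G` contains both `e` and `f`". -/
def IsRdComponent [DecidableEq V] (d : ℕ) (G : SimpleGraph V) (F : Set (Sym2 V)) : Prop :=
  ∃ e ∈ G.edgeSet, F = {f | f ∈ G.edgeSet ∧
    (e = f ∨ ∃ C, RdCircuitOf d G C ∧ e ∈ C ∧ f ∈ C)}

/-- The set of vertices covered by an edge set. -/
def vertexSpan (F : Set (Sym2 V)) : Set V := {v | ∃ e ∈ F, v ∈ e}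

/-- A nonempty edge set is `ℛ_d`-connected if any two of its edges lie on a common
`ℛ_d`-circuit contained in it (or are equal). -/
def RdConnectedSet [DecidableEq V] (d : ℕ) (F : Set (Sym2 V)) : Prop :=
  F.Nonempty ∧ ∀ e ∈ F, ∀ f ∈ F, e = f ∨ ∃ C, C ⊆ F ∧ RdCircuit d C ∧ e ∈ C ∧ f ∈ C

/-- A graph (with at least one edge) is `ℛ_d`-connected. -/
def RdConnected [DecidableEq V] (d : ℕ) (H : SimpleGraph V) : Prop :=
  RdConnectedSet d H.edgeSet

/-- `e` is an `ℛ_d`-bridge of `G`: `r_d(E ∖ {e}) = r_d(E) − 1`. -/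
def IsRdBridge [DecidableEq V] (d : ℕ) (G : SimpleGraph V) (e : Sym2 V) : Prop :=
  e ∈ G.edgeSet ∧ rd d (G.edgeSet \ {e}) + 1 = rd d G.edgeSet

/-- `G + uv`. -/
def addEdge (G : SimpleGraph V) (u v : V) : SimpleGraph V :=
  G ⊔ SimpleGraph.fromEdgeSet {s(u, v)}

/-- `{u,v}` is `d`-linked in `G` if `r_d(G+uv) = r_d(G)`. -/
def IsLinked [DecidableEq V] (d : ℕ) (G : SimpleGraph V) (u v : V) : Prop :=
  rd d (addEdge G u v).edgeSet = rd d G.edgeSet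

/-- There exist `k` pairwise internally vertex-disjoint `u`–`v` paths in `H`
(i.e. `κ_H(u,v) ≥ k`). -/
def InternallyDisjointPaths (H : SimpleGraph V) (u v : V) (k : ℕ) : Prop :=
  ∃ P : Fin k → H.Walk u v, (∀ i, (P i).IsPath) ∧
    ∀ i j, i ≠ j → ∀ w, w ∈ (P i).support → w ∈ (P j).support → w = u ∨ w = v

/-- An unordered pair forming a 2-separator: two distinct vertices whose deletion
disconnects the graph. -/
def TwoSepPair (H : SimpleGraph V) (e : Sym2 V) : Prop :=
  ¬ e.IsDiag ∧ ¬ (H.induce {v | v ∉ e}).Connected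

/-- The augmented graph `Ĥ`: add an edge for every 2-separator. -/
def aug (H : SimpleGraph V) : SimpleGraph V :=
  H ⊔ SimpleGraph.fromEdgeSet {e | TwoSepPair H e}

/-- A subgraph is 3-connected: at least 4 vertices, and deleting fewer than 3
vertices leaves it connected. -/
def IsThreeConnectedSubgraph {G : SimpleGraph V} (J : G.Subgraph) : Prop :=
  4 ≤ J.verts.ncard ∧ ∀ S : Set V, S.ncard < 3 → (J.deleteVerts S).coe.Connected

/-- A 3-block of `H`: a maximal 3-connected subgraph of the augmented graph `Ĥ`. -/
def IsThreeBlock (H : SimpleGraph V) (J : (aug H).Subgraph) : Prop :=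
  IsThreeConnectedSubgraph J ∧
    ∀ J' : (aug H).Subgraph, IsThreeConnectedSubgraph J' → J ≤ J' → J = J'

/-- `h_H(e)`: the number of 3-blocks of `H` containing both vertices of `e`. -/
def numBlocksOn (H : SimpleGraph V) (e : Sym2 V) : ℕ :=
  {J : (aug H).Subgraph | IsThreeBlock H J ∧ ∀ v ∈ e, v ∈ J.verts}.ncard

open Classical in
/-- `k(H) = Σ (h_H(ab) − 1)` over all 2-separators `{a,b}` of `H`. -/
def kGraph [Fintype V] [DecidableEq V] (H : SimpleGraph V) : ℕ :=
  ∑ e : Sym2 V, if TwoSepPair H e then numBlocksOn H e - 1 else 0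

/-- The graph of an `ℛ₂`-component, on its own vertex set. -/
def componentGraph [DecidableEq V] (F : Set (Sym2 V)) :
    SimpleGraph (vertexSpan F) :=
  (SimpleGraph.fromEdgeSet F).induce (vertexSpan F)

/-- `X` is the vertex set of an `ℛ_d`-block of `G`: a 3-block of a non-trivial
`ℛ_d`-component of `G`. -/
def IsRdBlockVerts [DecidableEq V] (d : ℕ) (G : SimpleGraph V) (X : Set V) : Prop :=
  ∃ F : Set (Sym2 V), IsRdComponent d G F ∧ 2 ≤ F.ncard ∧
    ∃ J : (aug (componentGraph F)).Subgraph,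
      IsThreeBlock (componentGraph F) J ∧ X = Subtype.val '' J.verts

/-- The globally linked closure of `G` in `ℝ^d`. -/
def glc (d : ℕ) (G : SimpleGraph V) : SimpleGraph V :=
  G ⊔ SimpleGraph.fromEdgeSet {e | ∃ u v : V, e = s(u, v) ∧ GloballyLinked d G u v}

/-- A globally `d`-linked cluster: the vertex set of a maximal complete subgraph of
`glc_d(G)`. -/
def IsCluster (d : ℕ) (G : SimpleGraph V) (X : Set V) : Prop :=
  (∀ a ∈ X, ∀ b ∈ X, a ≠ b → (glc d G).Adj a b) ∧
    ∀ Y : Set V, X ⊆ Y → (∀ a ∈ Y, ∀ b ∈ Y, a ≠ b → (glc d G).Adj a b) → Y = X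

/-- Equilibrium stress of a framework, encoded as a symmetric function vanishing on
non-edges. -/
def IsEqStress [Fintype V] {d : ℕ} (G : SimpleGraph V) (p : V → Fin d → ℝ)
    (ω : V → V → ℝ) : Prop :=
  (∀ u v, ω u v = ω v u) ∧ (∀ u v, ¬ G.Adj u v → ω u v = 0) ∧
    ∀ u, ∑ v, ω u v • (p u - p v) = 0

/-- `{u,v}` is `d`-stress-linked in `G`. -/
def StressLinked [Fintype V] (d : ℕ) (G : SimpleGraph V) (u v : V) : Prop :=
  ∀ p : V → Fin d → ℝ, Generic p → ∀ q : V → Fin d → ℝ,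
    (∀ ω, IsEqStress G p ω → IsEqStress G q ω) →
    ∀ ω, IsEqStress (addEdge G u v) p ω → IsEqStress (addEdge G u v) q ω

/-- Equivalence of complex frameworks. -/
def CEquivalent {d : ℕ} (G : SimpleGraph V) (p q : V → Fin d → ℂ) : Prop :=
  ∀ u v : V, G.Adj u v →
    ∑ i, (p u i - p v i) ^ 2 = ∑ i, (q u i - q v i) ^ 2

/-- Generic complex placement. -/
def CGeneric {d : ℕ} (p : V → Fin d → ℂ) : Prop :=
  AlgebraicIndependent ℚ (fun vi : V × Fin d => p vi.1 vi.2)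

/-- `{u,v}` is globally linked in `G` in `ℂ^d`. -/
def CGloballyLinked (d : ℕ) (G : SimpleGraph V) (u v : V) : Prop :=
  ∀ p : V → Fin d → ℂ, CGeneric p → ∀ q : V → Fin d → ℂ, CEquivalent G p q →
    ∑ i, (q u i - q v i) ^ 2 = ∑ i, (p u i - p v i) ^ 2

/-- A flexing of the framework `(G,q)`. -/
def IsFlexing {d : ℕ} (G : SimpleGraph V) (q : V → Fin d → ℝ)
    (φ : Set.Icc (0:ℝ) 1 → V → Fin d → ℝ) : Prop :=
  Continuous φ ∧ φ ⟨0, Set.left_mem_Icc.mpr zero_le_one⟩ = q ∧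
    (∀ t, Equivalent G q (φ t)) ∧
    ∀ t : Set.Icc (0:ℝ) 1, 0 < (t : ℝ) → ¬ Congruent q (φ t)

/-- A finite loopless multigraph on vertex type `V` with edge type `E`. -/
structure Multigraph (V : Type*) (E : Type*) where
  ends : E → Sym2 V
  loopless : ∀ e, ¬ (ends e).IsDiag

/-- The data `(B, bar)` exhibits `G` as a body-bar graph induced by `H`. -/
def IsBodyBar {V E W : Type*} (H : Multigraph V E) (G : SimpleGraph W)
    (B : V → Set W) (bar : E → W × W) : Prop :=
  (∀ w : W, ∃! v : V, w ∈ B v) ∧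
  (∀ v : V, (B v).ncard = {e : E | v ∈ H.ends e}.ncard) ∧
  (∀ e : E, ∃ w z : V, H.ends e = s(w, z) ∧ (bar e).1 ∈ B w ∧ (bar e).2 ∈ B z) ∧
  (∀ e : E, (bar e).1 ≠ (bar e).2) ∧
  (∀ e e' : E, e ≠ e' →
    ({(bar e).1, (bar e).2} ∩ {(bar e').1, (bar e').2} : Set W) = ∅) ∧
  (∀ a b : W, G.Adj a b ↔ a ≠ b ∧
    ((∃ v : V, a ∈ B v ∧ b ∈ B v) ∨ ∃ e : E, s(a, b) = s((bar e).1, (bar e).2)))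

/-- `P` is a partition of the set `X`. -/
def IsPartitionOf {V : Type*} (X : Set V) (P : Set (Set V)) : Prop :=
  (∀ p ∈ P, p.Nonempty ∧ p ⊆ X) ∧ ∀ v ∈ X, ∃! p, p ∈ P ∧ v ∈ p

/-- The subgraph `(X,F)` of the multigraph `H` is `k`-tree-connected. -/
def SubTreeConnected {V E : Type*} (k : ℕ) (H : Multigraph V E)
    (X : Set V) (F : Set E) : Prop :=
  X.Nonempty ∧ (∀ e ∈ F, ∀ v ∈ H.ends e, v ∈ X) ∧
    ∀ P : Set (Set V), IsPartitionOf X P →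
      k * (P.ncard - 1) ≤ {e | e ∈ F ∧ ¬ ∃ p ∈ P, ∀ v ∈ H.ends e, v ∈ p}.ncard

/-- `(X,F)` is a `k`-superbrick of `H`: a maximal `k`-tree-connected subgraph. -/
def IsSuperbrick {V E : Type*} (k : ℕ) (H : Multigraph V E)
    (X : Set V) (F : Set E) : Prop :=
  SubTreeConnected k H X F ∧
    ∀ X' F', SubTreeConnected k H X' F' → X ⊆ X' → F ⊆ F' → X = X' ∧ F = F'

/-- `(C, D)` is a separation of order at most two of the subgraph of `G` induced by `A`. -/
structure IsSep (G : SimpleGraph V) (A C D : Set V) : Prop where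
  union_eq : C ∪ D = A
  ncard_inter_le : (C ∩ D).ncard ≤ 2
  left_nonempty : (C \ D).Nonempty
  right_nonempty : (D \ C).Nonempty
  not_adj : ∀ u ∈ C \ D, ∀ v ∈ D \ C, ¬ G.Adj u v

/-- The subgraph of `G` induced by `A` has no separation of order at most two. -/
def Unsplit (G : SimpleGraph V) (A : Set V) : Prop := ∀ C D, ¬ IsSep G A C D

/-- Every separation of order at most two of `G[A]` is along a clique of `G`. -/
def CliqueSeps (G : SimpleGraph V) (A : Set V) : Prop :=
  ∀ C D, IsSep G A C D → G.IsClique (C ∩ D)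

/-- A maximal unsplit vertex set with at least four elements. -/
structure IsMaxUnsplit (G : SimpleGraph V) (X : Set V) : Prop where
  four_le : 4 ≤ X.ncard
  unsplit : Unsplit G X
  eq_of_subset : ∀ Y, Unsplit G Y → X ⊆ Y → X = Y

namespace IsSep

variable {G : SimpleGraph V} {A C D : Set V}

theorem symm (h : IsSep G A C D) : IsSep G A D C where
  union_eq := by rw [Set.union_comm, h.union_eq]
  ncard_inter_le := by rw [Set.inter_comm]; exact h.ncard_inter_le
  left_nonempty := h.right_nonempty
  right_nonempty := h.left_nonempty
  not_adj u hu v hv huv := h.not_adj v hv u hu huv.symm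

theorem left_subset (h : IsSep G A C D) : C ⊆ A := h.union_eq ▸ Set.subset_union_left

theorem right_subset (h : IsSep G A C D) : D ⊆ A := h.union_eq ▸ Set.subset_union_right

theorem left_ncard_lt [Finite V] (h : IsSep G A C D) : C.ncard < A.ncard := by
  refine Set.ncard_lt_ncard ⟨h.left_subset, fun hAC => ?_⟩ (Set.toFinite _)
  obtain ⟨v, hvD, hvC⟩ := h.right_nonempty
  exact hvC (hAC (h.right_subset hvD))

theorem mem_or (h : IsSep G A C D) {v : V} (hv : v ∈ A) : v ∈ C ∨ v ∈ D := by
  rw [← h.union_eq] at hv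
  exact hv

/-- An edge lies on one side of a separation. -/
theorem adj_mem (h : IsSep G A C D) {u v : V} (hu : u ∈ A) (hv : v ∈ A) (huv : G.Adj u v) :
    (u ∈ C ∧ v ∈ C) ∨ (u ∈ D ∧ v ∈ D) := by
  have h1 := h.mem_or hu
  have h2 := h.mem_or hv
  have h3 := fun a b => h.not_adj u a v b huv
  have h4 := fun a b => h.not_adj v a u b huv.symm
  simp only [Set.mem_sdiff] at h3 h4
  tauto

/-- A clique lies on one side of a separation. -/
theorem subset_or_of_isClique (h : IsSep G A C D) {S : Set V} (hS : G.IsClique S) (hSA : S ⊆ A) :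
    S ⊆ C ∨ S ⊆ D := by
  by_contra! hcon
  obtain ⟨⟨u, hu, huC⟩, v, hv, hvD⟩ := hcon.imp Set.not_subset.1 Set.not_subset.1
  have huD := (h.mem_or (hSA hu)).resolve_left huC
  have hvC := (h.mem_or (hSA hv)).resolve_right hvD
  exact h.not_adj v ⟨hvC, hvD⟩ u ⟨huD, huC⟩ (hS hv hu (by rintro rfl; exact huC hvC))

/-- An unsplit set lies on one side of a separation. -/
theorem subset_or_of_unsplit [Finite V] (h : IsSep G A C D) {K : Set V} (hK : Unsplit G K)
    (hKA : K ⊆ A) : K ⊆ C ∨ K ⊆ D := by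
  by_contra! hcon
  obtain ⟨⟨u, hu, huC⟩, v, hv, hvD⟩ := hcon.imp Set.not_subset.1 Set.not_subset.1
  have huD := (h.mem_or (hKA hu)).resolve_left huC
  have hvC := (h.mem_or (hKA hv)).resolve_right hvD
  refine hK (K ∩ C) (K ∩ D) ⟨?_, ?_, ⟨v, ⟨hv, hvC⟩, fun h => hvD h.2⟩,
    ⟨u, ⟨hu, huD⟩, fun h => huC h.2⟩, ?_⟩
  · rw [← Set.inter_union_distrib_left, h.union_eq, Set.inter_eq_left.2 hKA]
  · refine (Set.ncard_le_ncard ?_ (Set.toFinite _)).trans h.ncard_inter_le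
    exact fun x hx => ⟨hx.1.2, hx.2.2⟩
  · intro x hx y hy
    exact h.not_adj x ⟨hx.1.2, fun hD => hx.2 ⟨hx.1.1, hD⟩⟩ y ⟨hy.1.2, fun hC => hy.2 ⟨hy.1.1, hC⟩⟩

/-- A separation of one side of `(C, D)` whose left part contains `C ∩ D` extends to `A`. -/
theorem extend {C₁ D₁ : Set V} (h : IsSep G A C D) (h₁ : IsSep G C C₁ D₁) (hS : C ∩ D ⊆ C₁) :
    IsSep G A (C₁ ∪ D) D₁ ∧ (C₁ ∪ D) ∩ D₁ = C₁ ∩ D₁ := by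
  have hC₁ := h₁.left_subset
  have hD₁ := h₁.right_subset
  have key : ∀ x ∈ D, x ∈ D₁ → x ∈ C₁ := fun x hx hx' => hS ⟨hD₁ hx', hx⟩
  have heq : (C₁ ∪ D) ∩ D₁ = C₁ ∩ D₁ := by
    ext x
    have := key x
    simp only [Set.mem_inter_iff, Set.mem_union]
    tauto
  refine ⟨⟨?_, ?_, ?_, ?_, ?_⟩, heq⟩
  · rw [← h.union_eq, ← h₁.union_eq]
    ext x
    simp only [Set.mem_union]
    tauto
  · rw [heq]; exact h₁.ncard_inter_le
  · obtain ⟨x, hx, hx'⟩ := h₁.left_nonempty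
    exact ⟨x, Or.inl hx, hx'⟩
  · obtain ⟨x, hx, hx'⟩ := h₁.right_nonempty
    exact ⟨x, hx, fun hh => hx' (hh.elim id fun hD => key x hD hx)⟩
  · rintro u ⟨hu, hu'⟩ v ⟨hv, hv'⟩ huv
    have hvC₁ : v ∉ C₁ := fun hh => hv' (Or.inl hh)
    by_cases huC : u ∈ C₁
    · exact h₁.not_adj u ⟨huC, hu'⟩ v ⟨hv, hvC₁⟩ huv
    · have huD := hu.resolve_left huC
      exact h.not_adj v ⟨hD₁ hv, fun hh => hv' (Or.inr hh)⟩ u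
        ⟨huD, fun hh => huC (hS ⟨hh, huD⟩)⟩ huv.symm

theorem cliqueSeps_left (h : IsSep G A C D) (hA : CliqueSeps G A) : CliqueSeps G C := by
  intro C₁ D₁ h₁
  rcases h₁.subset_or_of_isClique (hA C D h) Set.inter_subset_left with hS | hS
  · obtain ⟨h2, heq⟩ := h.extend h₁ hS
    exact heq ▸ hA _ _ h2
  · obtain ⟨h2, heq⟩ := h.extend h₁.symm hS
    rw [Set.inter_comm]
    exact heq ▸ hA _ _ h2

end IsSep

theorem unsplit_of_isClique {G : SimpleGraph V} {S : Set V} (hS : G.IsClique S) :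
    Unsplit G S := by
  intro C D h
  rcases h.subset_or_of_isClique hS subset_rfl with h1 | h1
  · obtain ⟨x, hx, hx'⟩ := h.right_nonempty
    exact hx' (h1 (h.right_subset hx))
  · obtain ⟨x, hx, hx'⟩ := h.left_nonempty
    exact hx' (h1 (h.left_subset hx))

theorem Unsplit.exists_isMaxUnsplit [Finite V] {G : SimpleGraph V} {X : Set V}
    (hX : Unsplit G X) (h4 : 4 ≤ X.ncard) : ∃ Y, X ⊆ Y ∧ IsMaxUnsplit G Y := by
  obtain ⟨Y, hXY, hY⟩ := (Set.toFinite {Y : Set V | Unsplit G Y}).exists_le_maximal hX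
  exact ⟨Y, hXY, h4.trans (Set.ncard_le_ncard hXY (Set.toFinite _)), hY.prop,
    fun Z hZ hYZ => hY.eq_of_le hZ hYZ⟩

/-- Each set of the list, in turn, meets the union of `K` and the preceding ones in at most two
elements. -/
def Shelled {ι : Type*} (X : ι → Set V) : Set V → List ι → Prop
  | _, [] => True
  | K, i :: l => (K ∩ X i).ncard ≤ 2 ∧ Shelled X (K ∪ X i) l

section Shelled

variable {ι : Type*} {X : ι → Set V}

theorem Shelled.of_inter_subset [Finite V] {K S : Set V} {l : List ι} (h : Shelled X S l)
    (hKS : ∀ i ∈ l, K ∩ X i ⊆ S) : Shelled X K l := by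
  induction l generalizing K S with
  | nil => trivial
  | cons i l ih =>
    refine ⟨(Set.ncard_le_ncard (Set.subset_inter (hKS i (by simp)) Set.inter_subset_right)
      (Set.toFinite _)).trans h.1, ih h.2 ?_⟩
    rintro j hj x ⟨hx | hx, hx'⟩
    · exact Or.inl (hKS j (by simp [hj]) ⟨hx, hx'⟩)
    · exact Or.inr hx

theorem Shelled.append [Finite V] {A B K : Set V} {l₁ l₂ : List ι} (h₁ : Shelled X K l₁)
    (h₂ : Shelled X (A ∩ B) l₂) (hK : K ⊆ A) (hA : ∀ i ∈ l₁, X i ⊆ A) (hB : ∀ i ∈ l₂, X i ⊆ B) :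
    Shelled X K (l₁ ++ l₂) := by
  induction l₁ generalizing K with
  | nil => exact Shelled.of_inter_subset h₂ fun i hi x hx => Set.mem_inter (hK hx.1) (hB i hi hx.2)
  | cons i l ih =>
    exact ⟨h₁.1, ih h₁.2 (Set.union_subset hK (hA i (by simp))) fun j hj => hA j (by simp [hj])⟩

theorem Shelled.ncard_le [Finite V] {K : Set V} {l : List ι} (h : Shelled X K l) (j : Fin l.length) :
    ((K ∪ ⋃ (i : Fin l.length) (_ : i < j), X (l.get i)) ∩ X (l.get j)).ncard ≤ 2 := by
  induction l generalizing K with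
  | nil => exact j.elim0
  | cons a l ih =>
    induction j using Fin.cases with
    | zero => simpa using h.1
    | succ j =>
      refine le_trans (Set.ncard_le_ncard ?_ (Set.toFinite _)) (ih h.2 j)
      rintro x ⟨hx, hx'⟩
      refine ⟨?_, hx'⟩
      rcases hx with hx | hx
      · exact Or.inl (Or.inl hx)
      · simp only [Set.mem_iUnion] at hx
        obtain ⟨i, hi, hxi⟩ := hx
        induction i using Fin.cases with
        | zero => exact Or.inl (Or.inr hxi)
        | succ i =>
          refine Or.inr ?_
          simp only [Set.mem_iUnion]
          exact ⟨i, Fin.succ_lt_succ_iff.1 hi, hxi⟩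

/-- If all separations of order at most two are along cliques, the maximal unsplit sets in `A` can
be shelled starting from any clique on at most two vertices or any maximal unsplit set. -/
theorem exists_shelled [Finite V] [Finite ι] {G : SimpleGraph V} (hX : ∀ i, IsMaxUnsplit G (X i))
    (hinj : Function.Injective X) {A K : Set V} (hA : CliqueSeps G A) (hKA : K ⊆ A)
    (hK : Unsplit G K) (hK' : K.ncard ≤ 2 ∨ IsMaxUnsplit G K) :
    ∃ l : List ι, l.Nodup ∧ (∀ i, i ∈ l ↔ X i ⊆ A ∧ X i ≠ K) ∧ Shelled X K l := by
  induction hn : A.ncard using Nat.strong_induction_on generalizing A K with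
  | _ n ih =>
  by_cases hu : Unsplit G A
  · have hall : ∀ i, X i ⊆ A → X i = A := fun i hi => (hX i).eq_of_subset A hu hi
    by_cases hex : ∃ i, X i ⊆ A ∧ X i ≠ K
    · obtain ⟨i, hi, hiK⟩ := hex
      refine ⟨[i], by simp, fun j => ?_, ?_, trivial⟩
      · rw [List.mem_singleton]
        refine ⟨by rintro rfl; exact ⟨hi, hiK⟩, fun hj => hinj ?_⟩
        rw [hall i hi, hall j hj.1]
      · rcases hK' with h | h
        · exact (Set.ncard_le_ncard Set.inter_subset_left (Set.toFinite _)).trans h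
        · exact absurd ((hall i hi).trans (h.eq_of_subset A hu hKA).symm) hiK
    · push Not at hex
      refine ⟨[], by simp, fun j => ?_, trivial⟩
      simpa using hex j
  · simp only [Unsplit, not_forall, not_not] at hu
    obtain ⟨C, D, hCD⟩ := hu
    wlog hKC : K ⊆ C generalizing C D
    · exact this D C hCD.symm ((hCD.subset_or_of_unsplit hK hKA).resolve_left hKC)
    have hS := hA C D hCD
    obtain ⟨l₁, hn₁, hm₁, hs₁⟩ := ih _ (hn ▸ hCD.left_ncard_lt) (hCD.cliqueSeps_left hA) hKC hK
      hK' rfl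
    obtain ⟨l₂, hn₂, hm₂, hs₂⟩ := ih _ (hn ▸ hCD.symm.left_ncard_lt)
      (hCD.symm.cliqueSeps_left hA) Set.inter_subset_right (unsplit_of_isClique hS)
      (Or.inl hCD.ncard_inter_le) rfl
    have hnot : ∀ i, ¬ X i ⊆ C ∩ D := fun i hi => by
      have := Set.ncard_le_ncard hi (Set.toFinite _)
      have := (hX i).four_le
      have := hCD.ncard_inter_le
      omega
    refine ⟨l₁ ++ l₂, ?_, fun i => ?_, ?_⟩
    · refine List.nodup_append'.2 ⟨hn₁, hn₂, fun i hi hi' => ?_⟩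
      exact hnot i (Set.subset_inter ((hm₁ i).1 hi).1 ((hm₂ i).1 hi').1)
    · rw [List.mem_append, hm₁, hm₂]
      constructor
      · rintro (h | h)
        · exact ⟨h.1.trans hCD.left_subset, h.2⟩
        · refine ⟨h.1.trans hCD.right_subset, ?_⟩
          rintro rfl
          exact hnot i (Set.subset_inter hKC h.1)
      · rintro ⟨h, hne⟩
        rcases hCD.subset_or_of_unsplit (hX i).unsplit h with h' | h'
        · exact Or.inl ⟨h', hne⟩
        · exact Or.inr ⟨h', fun heq => hnot i heq.le⟩
    · exact hs₁.append hs₂ hKC (fun i hi => ((hm₁ i).1 hi).1) (fun i hi => ((hm₂ i).1 hi).1)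

end Shelled

theorem reachable_induct {W : Type*} {K : SimpleGraph W} {P : W → Prop}
    (hP : ∀ u v, K.Adj u v → P u → P v) {u v : W} (h : K.Reachable u v) (hu : P u) : P v := by
  obtain ⟨w⟩ := h
  induction w with
  | nil => exact hu
  | cons hadj _ ih => exact ih (hP _ _ hadj hu)

theorem cliqueSeps_aug_univ [Finite V] (H : SimpleGraph V) : CliqueSeps (aug H) Set.univ := by
  intro C D h x hx y hy hxy
  have hle : H ≤ aug H := le_sup_left
  have hS : C ∩ D = {x, y} := by
    refine (Set.eq_of_subset_of_ncard_le (by rintro z (rfl | rfl) <;> assumption) ?_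
      (Set.toFinite _)).symm
    rw [Set.ncard_pair hxy]
    exact h.ncard_inter_le
  refine Or.inr ?_
  rw [SimpleGraph.fromEdgeSet_adj]
  refine ⟨⟨by simpa using hxy, fun hconn => ?_⟩, hxy⟩
  obtain ⟨u, hu⟩ := h.left_nonempty
  obtain ⟨v, hv⟩ := h.right_nonempty
  have hmem : ∀ w, w ∉ s(x, y) ↔ w ∉ C ∩ D := fun w => by rw [hS]; simp
  have hreach := hconn.preconnected ⟨u, (hmem u).2 fun hh => hu.2 hh.2⟩
    ⟨v, (hmem v).2 fun hh => hv.2 hh.1⟩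
  refine hv.2 (reachable_induct (P := fun w => w.1 ∈ C) (fun a b hab ha => ?_) hreach hu.1)
  have haD : a.1 ∉ D := fun hh => (hmem a.1).1 a.2 ⟨ha, hh⟩
  by_contra hb
  exact h.not_adj a.1 ⟨ha, haD⟩ b.1 ⟨(h.mem_or (Set.mem_univ _)).resolve_left hb, hb⟩
    (hle hab)

theorem IsThreeConnectedSubgraph.unsplit {G : SimpleGraph V} {J : G.Subgraph}
    (hJ : IsThreeConnectedSubgraph J) : Unsplit G J.verts := by
  intro C D h
  have hconn := hJ.2 (C ∩ D) (Nat.lt_succ_of_le h.ncard_inter_le)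
  obtain ⟨u, hu⟩ := h.left_nonempty
  obtain ⟨v, hv⟩ := h.right_nonempty
  have hreach := hconn.preconnected ⟨u, h.left_subset hu.1, fun hh => hu.2 hh.2⟩
    ⟨v, h.right_subset hv.1, fun hh => hv.2 hh.1⟩
  refine hv.2 (reachable_induct (P := fun w => w.1 ∈ C) (fun a b hab ha => ?_) hreach hu.1)
  have haD : a.1 ∉ D := fun hh => a.2.2 ⟨ha, hh⟩
  by_contra hb
  exact h.not_adj a.1 ⟨ha, haD⟩ b.1 ⟨(h.mem_or b.2.1).resolve_left hb, hb⟩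
    ((J.deleteVerts (C ∩ D)).adj_sub hab)

theorem Unsplit.isThreeConnectedSubgraph [Finite V] {G : SimpleGraph V} {X : Set V}
    (hX : Unsplit G X) (h4 : 4 ≤ X.ncard) :
    IsThreeConnectedSubgraph ((⊤ : G.Subgraph).induce X) := by
  refine ⟨h4, fun S hS => ?_⟩
  have hne : (X \ S).Nonempty := by
    rw [Set.nonempty_iff_ne_empty, Ne, Set.sdiff_eq_empty]
    intro hXS
    have := Set.ncard_le_ncard hXS (Set.toFinite _)
    omega
  have : Nonempty (((⊤ : G.Subgraph).induce X).deleteVerts S).verts := hne.to_subtype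
  refine ⟨fun u v => ?_⟩
  by_contra huv
  set K := (((⊤ : G.Subgraph).induce X).deleteVerts S).coe
  refine hX {w | w ∈ X ∧ (w ∈ S ∨ ∃ h : w ∈ X \ S, K.Reachable u ⟨w, h⟩)}
    {w | w ∈ X ∧ (w ∈ S ∨ ∃ h : w ∈ X \ S, ¬ K.Reachable u ⟨w, h⟩)} ⟨?_, ?_, ?_, ?_, ?_⟩
  · ext w
    simp only [Set.mem_union, Set.mem_ofPred_eq]
    constructor
    · tauto
    · intro hw
      by_cases hwS : w ∈ S
      · tauto
      · by_cases hr : K.Reachable u ⟨w, hw, hwS⟩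
        · exact Or.inl ⟨hw, Or.inr ⟨⟨hw, hwS⟩, hr⟩⟩
        · exact Or.inr ⟨hw, Or.inr ⟨⟨hw, hwS⟩, hr⟩⟩
  · refine (Set.ncard_le_ncard ?_ (Set.toFinite S)).trans (Nat.lt_succ_iff.1 hS)
    rintro w ⟨⟨_, h1⟩, _, h2⟩
    rcases h1 with h1 | ⟨h, h1⟩
    · exact h1
    · rcases h2 with h2 | ⟨_, h2⟩
      · exact h2
      · exact absurd h1 h2
  · refine ⟨u.1, ⟨u.2.1, Or.inr ⟨u.2, SimpleGraph.Reachable.refl _⟩⟩, ?_⟩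
    rintro ⟨_, h | ⟨_, h⟩⟩
    · exact u.2.2 h
    · exact h (SimpleGraph.Reachable.refl _)
  · refine ⟨v.1, ⟨v.2.1, Or.inr ⟨v.2, huv⟩⟩, ?_⟩
    rintro ⟨_, h | ⟨_, h⟩⟩
    · exact v.2.2 h
    · exact huv h
  · rintro a ⟨⟨haX, ha⟩, ha'⟩ b ⟨⟨hbX, hb⟩, hb'⟩ hab
    have haS : a ∉ S := fun h => ha' ⟨haX, Or.inl h⟩
    have hbS : b ∉ S := fun h => hb' ⟨hbX, Or.inl h⟩
    obtain ⟨h1, hra⟩ := ha.resolve_left haS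
    obtain ⟨h2, hrb⟩ := hb.resolve_left hbS
    have hadj : K.Adj ⟨a, h1⟩ ⟨b, h2⟩ := by
      simp [K, haX, hbX, haS, hbS, hab]
    exact hrb (hra.trans hadj.reachable)

theorem IsThreeBlock.eq_induce [Finite V] {H : SimpleGraph V} {J : (aug H).Subgraph}
    (hJ : IsThreeBlock H J) : J = (⊤ : (aug H).Subgraph).induce J.verts :=
  hJ.2 _ (hJ.1.unsplit.isThreeConnectedSubgraph hJ.1.1) SimpleGraph.Subgraph.le_induce_top_verts

theorem IsThreeBlock.isMaxUnsplit [Finite V] {H : SimpleGraph V} {J : (aug H).Subgraph}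
    (hJ : IsThreeBlock H J) : IsMaxUnsplit (aug H) J.verts where
  four_le := hJ.1.1
  unsplit := hJ.1.unsplit
  eq_of_subset Y hY hJY := by
    have h4 : 4 ≤ Y.ncard := hJ.1.1.trans (Set.ncard_le_ncard hJY (Set.toFinite _))
    rw [hJ.2 _ (hY.isThreeConnectedSubgraph h4)
      (SimpleGraph.Subgraph.le_induce_top_verts.trans
        (SimpleGraph.Subgraph.induce_mono_right hJY))]
    rfl

theorem IsMaxUnsplit.isThreeBlock [Finite V] {H : SimpleGraph V} {X : Set V}
    (hX : IsMaxUnsplit (aug H) X) : IsThreeBlock H ((⊤ : (aug H).Subgraph).induce X) := by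
  refine ⟨hX.unsplit.isThreeConnectedSubgraph hX.four_le, fun J' hJ' hle => le_antisymm hle ?_⟩
  have heq : X = J'.verts := hX.eq_of_subset _ hJ'.unsplit hle.1
  rw [heq]
  exact SimpleGraph.Subgraph.le_induce_top_verts

/-- The first-order change of the squared length of `uv` (up to a factor of two) under the
velocities `q` at the placement `p`. -/
def stretch (p q : V → Fin 2 → ℝ) (u v : V) : ℝ := ∑ i, (p u i - p v i) * (q u i - q v i)

/-- Every infinitesimal motion of `G[A] - ab` at `p` preserves the length of `ab`. -/
def ImpliesEdge (G : SimpleGraph V) (p : V → Fin 2 → ℝ) (a b : V) (A : Set V) : Prop :=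
  ∀ q, (∀ u ∈ A, ∀ v ∈ A, G.Adj u v → s(u, v) ≠ s(a, b) → stretch p q u v = 0) →
    stretch p q a b = 0

/-- No three points of the planar placement are collinear. -/
def NoThreeCollinear (p : V → Fin 2 → ℝ) : Prop :=
  ∀ x y z, x ≠ y → x ≠ z → y ≠ z →
    (p y 0 - p x 0) * (p z 1 - p x 1) - (p y 1 - p x 1) * (p z 0 - p x 0) ≠ 0

theorem NoThreeCollinear.ne [Fintype V] {p : V → Fin 2 → ℝ} (hp : NoThreeCollinear p)
    (hV : 3 ≤ Fintype.card V) {x y : V} (hxy : x ≠ y) : p x ≠ p y := by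
  classical
  obtain ⟨z, hz⟩ : ∃ z, z ∉ ({x, y} : Finset V) := by
    by_contra! h
    have := Finset.card_le_card (s := Finset.univ) fun z _ => h z
    rw [Finset.card_univ, Finset.card_pair hxy] at this
    omega
  simp only [Finset.mem_insert, Finset.mem_singleton, not_or] at hz
  intro h
  exact hp x y z hxy (Ne.symm hz.1) (Ne.symm hz.2) (by rw [h]; ring)

/-- Velocities on at most two points that preserve their distance to first order agree with
those of an infinitesimal isometry of the plane. -/
theorem exists_infinitesimal_isometry [Finite V] {p : V → Fin 2 → ℝ}
    (hp : Function.Injective p) {S : Set V} (hS : S.ncard ≤ 2) (d : V → Fin 2 → ℝ)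
    (hd : ∀ x ∈ S, ∀ y ∈ S, stretch p d x y = 0) :
    ∃ τ : V → Fin 2 → ℝ, (∀ x ∈ S, τ x = d x) ∧ ∀ u v, stretch p τ u v = 0 := by
  suffices h : ∃ s c₀ c₁ : ℝ, ∀ x ∈ S, d x 0 = -s * p x 1 + c₀ ∧ d x 1 = s * p x 0 + c₁ by
    obtain ⟨s, c₀, c₁, h⟩ := h
    refine ⟨fun x => ![-s * p x 1 + c₀, s * p x 0 + c₁], fun x hx => ?_, fun u v => ?_⟩
    · ext i
      fin_cases i
      · exact (h x hx).1.symm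
      · exact (h x hx).2.symm
    · simp only [stretch, Fin.sum_univ_two, Matrix.cons_val_zero, Matrix.cons_val_one]
      ring
  by_cases hsub : S.Subsingleton
  · rcases hsub.eq_empty_or_singleton with rfl | ⟨x, rfl⟩
    · exact ⟨0, 0, 0, by simp⟩
    · exact ⟨0, d x 0, d x 1, by simp⟩
  · obtain ⟨x, hx, y, hy, hxy⟩ := Set.not_subsingleton_iff.1 hsub
    have hSxy : S = {x, y} := by
      refine (Set.eq_of_subset_of_ncard_le (by rintro z (rfl | rfl) <;> assumption) ?_
        (Set.toFinite _)).symm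
      rw [Set.ncard_pair hxy]
      exact hS
    have h0 := hd x hx y hy
    simp only [stretch, Fin.sum_univ_two] at h0
    have hN : (p x 0 - p y 0) ^ 2 + (p x 1 - p y 1) ^ 2 ≠ 0 := by
      intro h
      refine hxy (hp (funext fun i => ?_))
      have h0' : p x 0 - p y 0 = 0 := by nlinarith [sq_nonneg (p x 0 - p y 0)]
      have h1' : p x 1 - p y 1 = 0 := by nlinarith [sq_nonneg (p x 1 - p y 1)]
      fin_cases i
      · exact sub_eq_zero.1 h0'
      · exact sub_eq_zero.1 h1'
    set s := ((p x 0 - p y 0) * (d x 1 - d y 1) - (p x 1 - p y 1) * (d x 0 - d y 0)) /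
      ((p x 0 - p y 0) ^ 2 + (p x 1 - p y 1) ^ 2) with hs
    rw [eq_div_iff hN] at hs
    have e0 : d x 0 - d y 0 = -s * (p x 1 - p y 1) := by
      refine mul_right_cancel₀ hN ?_
      linear_combination (p x 0 - p y 0) * h0 + (p x 1 - p y 1) * hs
    have e1 : d x 1 - d y 1 = s * (p x 0 - p y 0) := by
      refine mul_right_cancel₀ hN ?_
      linear_combination (p x 1 - p y 1) * h0 - (p x 0 - p y 0) * hs
    refine ⟨s, d x 0 + s * p x 1, d x 1 - s * p x 0, fun z hz => ?_⟩
    rw [hSxy] at hz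
    rcases hz with rfl | rfl
    · constructor <;> ring
    · constructor <;> linarith

/-- Velocities on the two sides of a separation whose difference preserves the lengths on the
separator can be glued. -/
theorem IsSep.exists_glue [Finite V] {G : SimpleGraph V} {A C D : Set V} (h : IsSep G A C D)
    {p : V → Fin 2 → ℝ} (hp : Function.Injective p) (q₁ q₂ : V → Fin 2 → ℝ)
    (hq : ∀ x ∈ C ∩ D, ∀ y ∈ C ∩ D, stretch p q₁ x y = stretch p q₂ x y) :
    ∃ q, (∀ u ∈ C, ∀ v ∈ C, stretch p q u v = stretch p q₁ u v) ∧
      ∀ u ∈ D, ∀ v ∈ D, stretch p q u v = stretch p q₂ u v := by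
  classical
  have hadd : ∀ r s u v, stretch p (r + s) u v = stretch p r u v + stretch p s u v := by
    intro r s u v
    simp only [stretch, Fin.sum_univ_two, Pi.add_apply]
    ring
  have hd : ∀ x ∈ C ∩ D, ∀ y ∈ C ∩ D, stretch p (q₁ - q₂) x y = 0 := by
    intro x hx y hy
    have := hadd (q₁ - q₂) q₂ x y
    rw [sub_add_cancel, hq x hx y hy] at this
    linarith
  obtain ⟨τ, hτ, hτ0⟩ := exists_infinitesimal_isometry hp h.ncard_inter_le _ hd
  have hC : ∀ u ∈ C, C.piecewise q₁ (q₂ + τ) u = q₁ u := fun u hu => Set.piecewise_eq_of_mem _ _ _ hu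
  have hD : ∀ u ∈ D, C.piecewise q₁ (q₂ + τ) u = (q₂ + τ) u := fun u hu => by
    by_cases huC : u ∈ C
    · rw [hC u huC, Pi.add_apply, hτ u ⟨huC, hu⟩, Pi.sub_apply, add_sub_cancel]
    · exact Set.piecewise_eq_of_notMem _ _ _ huC
  refine ⟨C.piecewise q₁ (q₂ + τ), fun u hu v hv => ?_, fun u hu v hv => ?_⟩
  · simp only [stretch, hC u hu, hC v hv]
  · rw [← add_zero (stretch p q₂ u v), ← hτ0 u v, ← hadd]
    simp only [stretch, hD u hu, hD v hv]

theorem IsSep.impliesEdge_left [Finite V] {G : SimpleGraph V} {A C D : Set V}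
    (h : IsSep G A C D) (hS : G.IsClique (C ∩ D)) {p : V → Fin 2 → ℝ}
    (hp : Function.Injective p) {a b : V} (ha : a ∈ C) (hb : b ∈ C) (hab : ¬ (a ∈ D ∧ b ∈ D))
    (hA : ImpliesEdge G p a b A) : ImpliesEdge G p a b C := by
  intro q hq
  have h0 : ∀ u v, stretch p 0 u v = 0 := fun u v => by simp [stretch]
  obtain ⟨r, hrC, hrD⟩ := h.exists_glue hp q 0 fun x hx y hy => by
    rw [h0]
    by_cases hxy : x = y
    · simp [stretch, hxy]
    · refine hq x hx.1 y hy.1 (hS hx hy hxy) fun heq => hab ?_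
      rcases Sym2.eq_iff.1 heq with ⟨rfl, rfl⟩ | ⟨rfl, rfl⟩
      · exact ⟨hx.2, hy.2⟩
      · exact ⟨hy.2, hx.2⟩
  rw [← hrC a ha b hb]
  refine hA r fun u hu v hv huv hne => ?_
  rcases h.adj_mem hu hv huv with ⟨hu, hv⟩ | ⟨hu, hv⟩
  · rw [hrC u hu v hv]
    exact hq u hu v hv huv hne
  · rw [hrD u hu v hv, h0]

theorem IsSep.impliesEdge_or [Finite V] {G : SimpleGraph V} {A C D : Set V}
    (h : IsSep G A C D) {p : V → Fin 2 → ℝ} (hp : Function.Injective p) {a b : V} (hne : a ≠ b)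
    (ha : a ∈ C ∩ D) (hb : b ∈ C ∩ D) (hA : ImpliesEdge G p a b A) :
    ImpliesEdge G p a b C ∨ ImpliesEdge G p a b D := by
  by_contra! hcon
  simp only [ImpliesEdge, not_forall, exists_prop] at hcon
  obtain ⟨⟨q₁, hq₁, hne₁⟩, q₂, hq₂, hne₂⟩ := hcon
  have hsmul : ∀ u v, stretch p ((stretch p q₁ a b / stretch p q₂ a b) • q₂) u v =
      stretch p q₁ a b / stretch p q₂ a b * stretch p q₂ u v := fun u v => by
    simp only [stretch, Fin.sum_univ_two, Pi.smul_apply, smul_eq_mul]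
    ring
  have hcomm : ∀ q, stretch p q b a = stretch p q a b := fun q => by
    simp only [stretch, Fin.sum_univ_two]
    ring
  have hself : ∀ q u, stretch p q u u = 0 := fun q u => by simp [stretch]
  have hS : C ∩ D = {a, b} := by
    refine (Set.eq_of_subset_of_ncard_le (by rintro z (rfl | rfl) <;> assumption) ?_
      (Set.toFinite _)).symm
    rw [Set.ncard_pair hne]
    exact h.ncard_inter_le
  have hmatch : stretch p ((stretch p q₁ a b / stretch p q₂ a b) • q₂) a b =
      stretch p q₁ a b := by rw [hsmul, div_mul_cancel₀ _ hne₂]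
  obtain ⟨r, hrC, hrD⟩ := h.exists_glue hp q₁ ((stretch p q₁ a b / stretch p q₂ a b) • q₂) <| by
    rw [hS]
    rintro x (rfl | rfl) y (rfl | rfl)
    · simp only [hself]
    · exact hmatch.symm
    · rw [hcomm, hcomm, hmatch]
    · simp only [hself]
  refine hne₁ ?_
  rw [← hrC a ha.1 b hb.1]
  refine hA r fun u hu v hv huv hne => ?_
  rcases h.adj_mem hu hv huv with ⟨hu, hv⟩ | ⟨hu, hv⟩
  · rw [hrC u hu v hv]
    exact hq₁ u hu v hv huv hne
  · rw [hrD u hu v hv, hsmul, hq₂ u hu v hv huv hne, mul_zero]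

/-- At a placement in general position, three vertices never imply an edge. -/
theorem ImpliesEdge.four_le [Finite V] {G : SimpleGraph V} {p : V → Fin 2 → ℝ}
    (hp : Function.Injective p) (hp' : NoThreeCollinear p) {a b : V} {A : Set V} (ha : a ∈ A)
    (hb : b ∈ A) (hab : a ≠ b) (hA : ImpliesEdge G p a b A) : 4 ≤ A.ncard := by
  classical
  by_contra hlt
  obtain ⟨c, hAc⟩ : ∃ c, A ⊆ {a, b, c} := by
    have hsub : (A \ {a, b}).Subsingleton := by
      rw [← Set.ncard_le_one_iff_subsingleton]
      have := Set.ncard_sdiff_add_ncard_of_subset (s := {a, b}) (t := A)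
        (by rintro z (rfl | rfl) <;> assumption)
      rw [Set.ncard_pair hab] at this
      omega
    rcases hsub.eq_empty_or_singleton with h | ⟨c, h⟩
    · refine ⟨a, fun x hx => ?_⟩
      have : x ∉ A \ {a, b} := by simp [h]
      simp only [Set.mem_sdiff, Set.mem_insert_iff, Set.mem_singleton_iff] at this ⊢
      tauto
    · refine ⟨c, fun x hx => ?_⟩
      have : x ∈ A \ {a, b} ↔ x = c := by rw [h]; rfl
      simp only [Set.mem_sdiff, Set.mem_insert_iff, Set.mem_singleton_iff] at this ⊢
      tauto
  -- rotate `a` about `c` (or translate it along `ab` when `c` is not a third vertex)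
  obtain ⟨w, hwab, hwc⟩ : ∃ w : Fin 2 → ℝ, ∑ i, (p a i - p b i) * w i ≠ 0 ∧
      (c ≠ a → c ≠ b → ∑ i, (p a i - p c i) * w i = 0) := by
    by_cases hc : c ≠ a ∧ c ≠ b
    · refine ⟨![-(p a 1 - p c 1), p a 0 - p c 0], fun h0 => ?_, fun _ _ => ?_⟩
      · refine hp' a b c hab (Ne.symm hc.1) (Ne.symm hc.2) ?_
        simp only [Fin.sum_univ_two, Matrix.cons_val_zero, Matrix.cons_val_one] at h0
        linear_combination -h0
      · simp only [Fin.sum_univ_two, Matrix.cons_val_zero, Matrix.cons_val_one]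
        ring
    · refine ⟨p a - p b, fun h0 => hab (hp (funext fun i => ?_)), fun h1 h2 => absurd ⟨h1, h2⟩ hc⟩
      simp only [Pi.sub_apply] at h0
      rw [Finset.sum_eq_zero_iff_of_nonneg fun i _ => mul_self_nonneg _] at h0
      exact sub_eq_zero.1 (mul_self_eq_zero.1 (h0 i (Finset.mem_univ i)))
  have hq : ∀ v, v ≠ a → Function.update (0 : V → Fin 2 → ℝ) a w v = 0 := fun v hv => by
    rw [Function.update_of_ne hv, Pi.zero_apply]
  refine hwab ?_
  have := hA (Function.update 0 a w) ?_
  · simpa [stretch, hq b hab.symm] using this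
  · have key : ∀ v ∈ A, v ≠ a → v ≠ b → ∑ i, (p a i - p v i) * w i = 0 := fun v hv hva hvb => by
      obtain rfl : v = c := by
        have := hAc hv
        simp only [Set.mem_insert_iff, Set.mem_singleton_iff] at this
        tauto
      exact hwc hva hvb
    intro u hu v hv huv hne
    have huv' := huv.ne
    by_cases hua : u = a
    · subst hua
      have hvb : v ≠ b := by rintro rfl; exact hne rfl
      simpa [stretch, hq v huv'.symm] using key v hv huv'.symm hvb
    · by_cases hva : v = a
      · subst hva
        have hub : u ≠ b := by rintro rfl; exact hne Sym2.eq_swap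
        have := key u hu hua hub
        simp only [stretch, hq u hua, Function.update_self, Fin.sum_univ_two, Pi.zero_apply]
          at this ⊢
        linarith
      · simp [stretch, hq u hua, hq v hva]

theorem exists_unsplit_of_impliesEdge [Finite V] {G : SimpleGraph V} {p : V → Fin 2 → ℝ}
    (hp : Function.Injective p) {a b : V} (hab : G.Adj a b) {A : Set V} (hG : CliqueSeps G A)
    (ha : a ∈ A) (hb : b ∈ A) (hA : ImpliesEdge G p a b A) :
    ∃ X, Unsplit G X ∧ a ∈ X ∧ b ∈ X ∧ ImpliesEdge G p a b X := by
  induction hn : A.ncard using Nat.strong_induction_on generalizing A with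
  | _ n ih =>
  by_cases hu : Unsplit G A
  · exact ⟨A, hu, ha, hb, hA⟩
  simp only [Unsplit, not_forall, not_not] at hu
  obtain ⟨C, D, h⟩ := hu
  wlog hC : a ∈ C ∧ b ∈ C ∧ ImpliesEdge G p a b C generalizing C D
  · refine this D C h.symm ?_
    by_cases hS : a ∈ C ∩ D ∧ b ∈ C ∩ D
    · refine ⟨hS.1.2, hS.2.2, (h.impliesEdge_or hp hab.ne hS.1 hS.2 hA).resolve_left fun h' => ?_⟩
      exact hC ⟨hS.1.1, hS.2.1, h'⟩
    · rcases h.adj_mem ha hb hab with ⟨haC, hbC⟩ | ⟨haD, hbD⟩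
      · exact absurd ⟨haC, hbC, h.impliesEdge_left (hG C D h) hp haC hbC
          (fun hD => hS ⟨⟨haC, hD.1⟩, hbC, hD.2⟩) hA⟩ hC
      · exact ⟨haD, hbD, h.symm.impliesEdge_left (hG D C h.symm) hp haD hbD
          (fun hD => hS ⟨⟨hD.1, haD⟩, hD.2, hbD⟩) hA⟩
  exact ih _ (hn ▸ h.left_ncard_lt) (h.cliqueSeps_left hG) hC.1 hC.2.1 hC.2.2 rfl

section Rows

variable [DecidableEq V]

theorem edgeVec_comm {d : ℕ} (p : V → Fin d → ℝ) (u v : V) : edgeVec p u v = edgeVec p v u := by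
  ext ⟨w, i⟩
  simp only [edgeVec]
  split_ifs with h1 h2
  · rw [← h1, h2]
  · rfl
  · rfl
  · rfl

/-- The row of the rigidity matrix of an unordered pair. -/
def edgeRow {d : ℕ} (p : V → Fin d → ℝ) : Sym2 V → V × Fin d → ℝ :=
  Sym2.lift ⟨edgeVec p, edgeVec_comm p⟩

@[simp]
theorem edgeRow_mk {d : ℕ} (p : V → Fin d → ℝ) (u v : V) : edgeRow p s(u, v) = edgeVec p u v := rfl

theorem rankAt_eq {d : ℕ} (p : V → Fin d → ℝ) (F : Set (Sym2 V)) :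
    rankAt d p F = Module.finrank ℝ (Submodule.span ℝ (edgeRow p '' F)) := by
  suffices h : {x | ∃ u v, s(u, v) ∈ F ∧ x = edgeVec p u v} = edgeRow p '' F by rw [rankAt, h]
  ext x
  constructor
  · rintro ⟨u, v, h, rfl⟩
    exact ⟨_, h, rfl⟩
  · rintro ⟨f, h, rfl⟩
    induction f with | _ u v => exact ⟨u, v, h, rfl⟩

theorem rankAt_le_ncard [Finite V] {d : ℕ} (p : V → Fin d → ℝ) (F : Set (Sym2 V)) :
    rankAt d p F ≤ F.ncard := by
  have := Fintype.ofFinite F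
  rw [rankAt_eq, ← Nat.card_coe_set_eq, Nat.card_eq_fintype_card, Set.image_eq_range]
  exact finrank_range_le_card _

theorem linearIndepOn_edgeRow_iff [Finite V] {d : ℕ} (p : V → Fin d → ℝ) (F : Set (Sym2 V)) :
    LinearIndepOn ℝ (edgeRow p) F ↔ rankAt d p F = F.ncard := by
  have := Fintype.ofFinite F
  rw [rankAt_eq, ← Nat.card_coe_set_eq, Nat.card_eq_fintype_card, Set.image_eq_range, LinearIndepOn,
    linearIndependent_iff_card_eq_finrank_span, eq_comm]
  rfl

theorem rdIndep_iff_exists [Finite V] {d : ℕ} (F : Set (Sym2 V)) :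
    RdIndep d F ↔ ∃ p : V → Fin d → ℝ, LinearIndepOn ℝ (edgeRow p) F := by
  have hbdd : BddAbove {n : ℕ | ∃ p : V → Fin d → ℝ, n = rankAt d p F} :=
    ⟨F.ncard, by rintro _ ⟨p, rfl⟩; exact rankAt_le_ncard p F⟩
  simp only [linearIndepOn_edgeRow_iff]
  constructor
  · intro h
    have hne : {n : ℕ | ∃ p : V → Fin d → ℝ, n = rankAt d p F}.Nonempty := ⟨_, 0, rfl⟩
    obtain ⟨p, hp⟩ := Nat.sSup_mem hne hbdd
    exact ⟨p, hp.symm.trans h⟩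
  · rintro ⟨p, hp⟩
    refine le_antisymm (csSup_le ⟨_, p, rfl⟩ ?_) (le_csSup hbdd ⟨p, hp.symm⟩)
    rintro _ ⟨q, rfl⟩
    exact rankAt_le_ncard q F

theorem sum_edgeVec_mul [Fintype V] (p q : V → Fin 2 → ℝ) (u v : V) :
    ∑ wi, edgeVec p u v wi * q wi.1 wi.2 = stretch p q u v := by
  by_cases huv : u = v
  · subst huv
    simp [edgeVec, stretch]
  · have h : ∀ w i, edgeVec p u v (w, i) * q w i =
        (if w = u then (p u i - p v i) * q u i else 0) +
          if w = v then (p v i - p u i) * q v i else 0 := by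
      intro w i
      simp only [edgeVec]
      split_ifs with h1 h2 h2
      · exact absurd (h1.symm.trans h2) huv
      · rw [h1, add_zero]
      · rw [h2, zero_add]
      · simp
    rw [Fintype.sum_prod_type_right]
    simp only [h, Finset.sum_add_distrib, Finset.sum_ite_eq', Finset.mem_univ, if_true, stretch,
      Fin.sum_univ_two]
    ring

theorem continuous_edgeRow {d : ℕ} (f : Sym2 V) :
    Continuous fun p : V → Fin d → ℝ => edgeRow p f := by
  induction f with | _ u v =>
  refine continuous_pi fun wi => ?_
  simp only [edgeRow_mk, edgeVec]
  split_ifs <;> fun_prop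

/-- Independence of rows at some placement persists at some placement in general position. -/
theorem exists_noThreeCollinear_linearIndepOn [Finite V] {p : V → Fin 2 → ℝ} {F : Set (Sym2 V)}
    (h : LinearIndepOn ℝ (edgeRow p) F) :
    ∃ q : V → Fin 2 → ℝ, NoThreeCollinear q ∧ LinearIndepOn ℝ (edgeRow q) F := by
  have := Fintype.ofFinite V
  obtain ⟨n, ⟨φ⟩⟩ := Finite.exists_equiv_fin V
  let w : V → Fin 2 → ℝ := fun v => ![(φ v : ℝ), (φ v : ℝ) ^ 2]
  have hcont : Continuous fun t : ℝ => fun f : F => edgeRow (p + t • w) f :=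
    continuous_pi fun f => (continuous_edgeRow f.1).comp (by fun_prop)
  have hind : ∀ᶠ t : ℝ in nhdsWithin 0 {0}ᶜ, LinearIndepOn ℝ (edgeRow (p + t • w)) F := by
    refine nhdsWithin_le_nhds ?_
    refine hcont.continuousAt.eventually_mem (isOpen_setOfPred_linearIndependent.mem_nhds ?_)
    simpa [LinearIndepOn] using h
  have hcol : ∀ᶠ t : ℝ in nhdsWithin 0 {0}ᶜ, NoThreeCollinear (p + t • w) := by
    simp only [NoThreeCollinear, Filter.eventually_all]
    intro x y z hxy hxz hyz
    open Polynomial in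
    let P : ℝ[X] := (C (p y 0 - p x 0) + C (w y 0 - w x 0) * X) *
        (C (p z 1 - p x 1) + C (w z 1 - w x 1) * X) -
      (C (p y 1 - p x 1) + C (w y 1 - w x 1) * X) * (C (p z 0 - p x 0) + C (w z 0 - w x 0) * X)
    have hP : P ≠ 0 := by
      intro h0
      have h2 := congrArg (fun Q => Q.coeff 2) h0
      have hne : ∀ {a b : V}, a ≠ b → (φ a : ℝ) - φ b ≠ 0 := fun hab h' => hab <| by
        have := sub_eq_zero.1 h'
        exact φ.injective (Fin.ext (by exact_mod_cast this))
      have h3 : ((φ y : ℝ) - φ x) * ((φ z : ℝ) - φ x) * ((φ z : ℝ) - φ y) = 0 := by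
        have hc : ∀ a b c d : ℝ, ((Polynomial.C a + Polynomial.C b * Polynomial.X) *
            (Polynomial.C c + Polynomial.C d * Polynomial.X)).coeff 2 = b * d := by
          intro a b c d
          have : (Polynomial.C a + Polynomial.C b * Polynomial.X) *
              (Polynomial.C c + Polynomial.C d * Polynomial.X) =
              Polynomial.C (b * d) * Polynomial.X ^ 2 + Polynomial.C (a * d + b * c) *
                Polynomial.X ^ 1 + Polynomial.C (a * c) := by
            simp only [Polynomial.C_mul, Polynomial.C_add]
            ring
          rw [this]
          simp only [Polynomial.coeff_add, Polynomial.coeff_C_mul_X_pow, Polynomial.coeff_C]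
          norm_num
        simp only [P, Polynomial.coeff_sub, hc, Polynomial.coeff_zero, w, Matrix.cons_val_zero,
          Matrix.cons_val_one] at h2
        linear_combination h2
      exact mul_ne_zero (mul_ne_zero (hne hxy.symm) (hne hxz.symm)) (hne hyz.symm) h3
    have hfin : {t : ℝ | P.IsRoot t}.Finite := Polynomial.finite_setOfPred_isRoot hP
    have hev : ∀ᶠ t : ℝ in nhdsWithin 0 {0}ᶜ, t ∉ {t : ℝ | P.IsRoot t} \ {0} :=
      nhdsWithin_le_nhds ((hfin.sdiff.isClosed.isOpen_compl).mem_nhds (by simp))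
    filter_upwards [hev, self_mem_nhdsWithin] with t ht ht0 hzero
    refine ht ⟨?_, ht0⟩
    simp only [Set.mem_ofPred_eq, Polynomial.IsRoot.def, P, Polynomial.eval_sub, Polynomial.eval_mul,
      Polynomial.eval_add, Polynomial.eval_C, Polynomial.eval_X]
    simp only [Pi.add_apply, Pi.smul_apply, smul_eq_mul] at hzero
    linear_combination hzero
  obtain ⟨t, h1, h2⟩ := (hcol.and hind).exists
  exact ⟨_, h1, h2⟩

theorem RdCircuit.exists_impliesEdge [Fintype V] {H : SimpleGraph V} {Z : Set (Sym2 V)} {a b : V}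
    (hZ : RdCircuit 2 Z) (hZH : Z ⊆ H.edgeSet) (hab : s(a, b) ∈ Z) :
    ∃ p : V → Fin 2 → ℝ, NoThreeCollinear p ∧ ImpliesEdge H p a b Set.univ := by
  obtain ⟨p₀, hp₀⟩ := (rdIndep_iff_exists _).1
    (hZ.2 (Z \ {s(a, b)}) (Set.sdiff_singleton_ssubset.2 hab))
  obtain ⟨p, hp, hind⟩ := exists_noThreeCollinear_linearIndepOn hp₀
  refine ⟨p, hp, fun q hq => ?_⟩
  have hspan : edgeRow p s(a, b) ∈ Submodule.span ℝ (edgeRow p '' (Z \ {s(a, b)})) := by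
    by_contra hnot
    have := (linearIndepOn_insert (by simp)).2 ⟨hind, hnot⟩
    rw [Set.insert_sdiff_singleton, Set.insert_eq_of_mem hab] at this
    exact hZ.1 ((rdIndep_iff_exists _).2 ⟨p, this⟩)
  rw [← sum_edgeVec_mul]
  refine Submodule.span_induction (p := fun x _ => ∑ wi, x wi * q wi.1 wi.2 = 0) ?_ (by simp) ?_ ?_
    hspan
  · rintro _ ⟨f, ⟨hf, hne⟩, rfl⟩
    induction f with | _ u v =>
    rw [edgeRow_mk, sum_edgeVec_mul]
    exact hq u trivial v trivial (hZH hf) hne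
  · intro x y _ _ hx hy
    simp only [Pi.add_apply, add_mul, Finset.sum_add_distrib, hx, hy, add_zero]
  · intro c x _ hx
    simp only [Pi.smul_apply, smul_eq_mul, mul_assoc, ← Finset.mul_sum, hx, mul_zero]

end Rows

/-- A graph on at least five vertices with a single edge has a complete augmented graph. -/
theorem aug_adj_of_edgeSet_subset_singleton [Fintype V] {H : SimpleGraph V} {a b : V}
    (hV : 5 ≤ Fintype.card V) (hH : ∀ f ∈ H.edgeSet, f = s(a, b)) {x y : V} (hxy : x ≠ y) :
    (aug H).Adj x y := by
  classical
  have hex : ∀ S : Finset V, S.card ≤ 4 → ∃ z, z ∉ S := fun S hS => by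
    by_contra! h
    have := Finset.card_le_card (s := Finset.univ) fun z _ => h z
    rw [Finset.card_univ] at this
    omega
  refine Or.inr ?_
  rw [SimpleGraph.fromEdgeSet_adj]
  refine ⟨⟨by simpa using hxy, fun hconn => ?_⟩, hxy⟩
  obtain ⟨c, hc⟩ := hex {x, y, a, b} Finset.card_le_four
  obtain ⟨d, hd⟩ := hex {x, y, c} (Finset.card_le_three.trans (by norm_num))
  simp only [Finset.mem_insert, Finset.mem_singleton, not_or] at hc hd
  have hreach := hconn.preconnected ⟨c, by simp [hc.1, hc.2.1]⟩ ⟨d, by simp [hd.1, hd.2.1]⟩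
  refine hd.2.2 (reachable_induct (P := fun w => w.1 = c) (fun u v huv hu => ?_) hreach rfl)
  have hcv : c ∈ s(a, b) := by
    rw [← hH s(u.1, v.1) huv, ← hu]
    exact Sym2.mem_mk_left _ _
  rcases Sym2.mem_iff.1 hcv with h | h
  · exact absurd h hc.2.2.1
  · exact absurd h hc.2.2.2

/-- Unless `H` is a single edge on four vertices, each edge of an `ℛ₂`-connected graph `H` lies in
a maximal unsplit set of the augmented graph. -/
theorem exists_isMaxUnsplit_mem [Fintype V] [DecidableEq V] {H : SimpleGraph V}
    (hH : RdConnected 2 H) (hV : 4 ≤ Fintype.card V) {a b : V}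
    (h4 : ¬ (Fintype.card V = 4 ∧ ∀ f ∈ H.edgeSet, f = s(a, b))) (hab : H.Adj a b) :
    ∃ X, IsMaxUnsplit (aug H) X ∧ a ∈ X ∧ b ∈ X := by
  have hle : H ≤ aug H := le_sup_left
  suffices h : ∃ X, Unsplit (aug H) X ∧ 4 ≤ X.ncard ∧ a ∈ X ∧ b ∈ X by
    obtain ⟨X, hX, hX4, haX, hbX⟩ := h
    obtain ⟨Y, hXY, hY⟩ := hX.exists_isMaxUnsplit hX4
    exact ⟨Y, hY, hXY haX, hXY hbX⟩
  by_cases hf : ∀ f ∈ H.edgeSet, f = s(a, b)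
  · refine ⟨Set.univ, unsplit_of_isClique fun x _ y _ hxy => ?_, ?_, trivial, trivial⟩
    · exact aug_adj_of_edgeSet_subset_singleton (by have : Fintype.card V ≠ 4 := fun h => h4 ⟨h, hf⟩; omega) hf hxy
    · rwa [Set.ncard_univ, Nat.card_eq_fintype_card]
  · push Not at hf
    obtain ⟨f, hf, hne⟩ := hf
    obtain ⟨Z, hZH, hZ, heZ, -⟩ := (hH.2 s(a, b) hab f hf).resolve_left (Ne.symm hne)
    obtain ⟨p, hp, himp⟩ := hZ.exists_impliesEdge hZH heZ
    have hinj : Function.Injective p := fun x y h => by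
      by_contra hxy
      exact hp.ne (by omega) hxy h
    obtain ⟨X, hX, haX, hbX, himpX⟩ := exists_unsplit_of_impliesEdge hinj (hle hab)
      (cliqueSeps_aug_univ H) (Set.mem_univ a) (Set.mem_univ b)
      fun q hq => himp q fun u hu v hv huv => hq u hu v hv (hle huv)
    exact ⟨X, hX, himpX.four_le hinj hp haX hbX hab.ne, haX, hbX⟩

/-- For an `ℛ₂`-connected graph `H` on at least 4 vertices with 3-blocks
`J₁, …, J_t` and any edge `e` of `H`, the vertex sets of the 3-blocks admit a
2-shellable ordering whose first set contains both endpoints of `e`. -/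
theorem blocks_two_shellable {V : Type*} [Fintype V] [DecidableEq V]
    (H : SimpleGraph V) (hH : RdConnected 2 H) (hV : 4 ≤ Fintype.card V)
    (t : ℕ) (J : Fin t → (aug H).Subgraph)
    (hJ : ∀ i, IsThreeBlock H (J i)) (hinj : Function.Injective J)
    (hall : ∀ B : (aug H).Subgraph, IsThreeBlock H B → ∃ i, B = J i)
    (e : Sym2 V) (he : e ∈ H.edgeSet) :
    ∃ σ : Equiv.Perm (Fin t),
      (∀ j : Fin t,
        ((⋃ (i : Fin t) (_ : i < j), (J (σ i)).verts) ∩ (J (σ j)).verts).ncard ≤ 2) ∧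
      ∀ j : Fin t, (j : ℕ) = 0 → ∀ w ∈ e, w ∈ (J (σ j)).verts := by
  induction e with | _ a b =>
  have hadj : H.Adj a b := he
  rcases t.eq_zero_or_pos with rfl | ht
  · exact ⟨Equiv.refl _, fun j => j.elim0, fun j => j.elim0⟩
  obtain ⟨i₀, ha, hb⟩ : ∃ i, a ∈ (J i).verts ∧ b ∈ (J i).verts := by
    by_cases h4 : Fintype.card V = 4 ∧ ∀ f ∈ H.edgeSet, f = s(a, b)
    · have huniv : (J ⟨0, ht⟩).verts = Set.univ := by
        refine Set.eq_of_subset_of_ncard_le (Set.subset_univ _) ?_ (Set.toFinite _)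
        rw [Set.ncard_univ, Nat.card_eq_fintype_card, h4.1]
        exact (hJ _).1.1
      exact ⟨⟨0, ht⟩, by simp [huniv], by simp [huniv]⟩
    obtain ⟨X, hX, haX, hbX⟩ := exists_isMaxUnsplit_mem hH hV h4 hadj
    obtain ⟨i, hi⟩ := hall _ hX.isThreeBlock
    exact ⟨i, hi ▸ haX, hi ▸ hbX⟩
  have hverts : Function.Injective fun i => (J i).verts := fun i j hij => hinj <| by
    rw [(hJ i).eq_induce, (hJ j).eq_induce]
    exact congrArg _ hij
  obtain ⟨l, hnodup, hmem, hshell⟩ := exists_shelled (fun i => (hJ i).isMaxUnsplit) hverts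
    (cliqueSeps_aug_univ H) (Set.subset_univ _) (hJ i₀).isMaxUnsplit.unsplit
    (Or.inr (hJ i₀).isMaxUnsplit)
  have hnodup' : (i₀ :: l).Nodup := List.nodup_cons.2 ⟨fun h => ((hmem i₀).1 h).2 rfl, hnodup⟩
  have hmem' : ∀ i, i ∈ i₀ :: l := fun i => by
    rw [List.mem_cons, hmem]
    by_cases h : i = i₀
    · exact Or.inl h
    · exact Or.inr ⟨Set.subset_univ _, fun heq => h (hverts heq)⟩
  have hshell' : Shelled (fun i => (J i).verts) ∅ (i₀ :: l) := ⟨by simp, by simpa using hshell⟩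
  let φ := hnodup'.getEquivOfForallMemList _ hmem'
  have hlen : (i₀ :: l).length = t := by simpa using Fintype.card_congr φ
  refine ⟨(finCongr hlen.symm).trans φ, fun j => ?_, fun j hj => ?_⟩
  · refine le_trans (Set.ncard_le_ncard ?_ (Set.toFinite _))
      (hshell'.ncard_le (finCongr hlen.symm j))
    refine Set.inter_subset_inter_left _ (Set.subset_union_of_subset_right ?_ _)
    exact Set.iUnion₂_subset fun i hi => Set.subset_iUnion₂_of_subset (finCongr hlen.symm i)
      hi subset_rfl
  · have hσ : (finCongr hlen.symm).trans φ j = i₀ := by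
      have : finCongr hlen.symm j = ⟨0, by simp⟩ := Fin.ext hj
      rw [Equiv.trans_apply, this]
      rfl
    rw [hσ]
    intro w hw
    rcases Sym2.mem_iff.1 hw with rfl | rfl
    · exact ha
    · exact hb

end Rigidity
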